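/- For every nonnegative integer n, p_3(17n + 15) ≡ 0 (mod 17). -/

import Mathlib

/-- `multipartition r n` is the number of `r`-component multipartitions of `n`,
i.e. the number of `r`-tuples of integer partitions whose sizes sum to `n`. -/
def multipartition (r n : ℕ) : ℕ :=
  ∑ c ∈ Finset.Nat.antidiagonalTuple r n, ∏ i, Fintype.card (Nat.Partition (c i))

namespace MP
open PowerSeries

noncomputable def partGF (R : Type*) [CommRing R] : R⟦X⟧ :=
  PowerSeries.mk fun n => (Fintype.card (Nat.Partition n) : R)

lemma coeff_partGF_cube (R : Type*) [CommRing R] (n : ℕ) :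
    coeff n ((partGF R)^3) = (multipartition 3 n : R) := by
  have h : (partGF R)^3 = ∏ _i : Fin 3, partGF R := by simp
  rw [h, coeff_prod, multipartition]
  push_cast
  refine Finset.sum_bij' (fun a _ => (a : Fin 3 → ℕ)) (fun a _ => Finsupp.equivFunOnFinite.symm a)
    ?_ ?_ ?_ ?_ ?_
  · intro a ha
    simp only [Finset.mem_finsuppAntidiag] at ha
    simpa [Finset.Nat.mem_antidiagonalTuple] using ha.1
  · intro a ha
    simp only [Finset.Nat.mem_antidiagonalTuple] at ha
    simp [Finset.mem_finsuppAntidiag, ha]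
  · intro a ha; simp
  · intro a ha; simp
  · intro a ha; simp [partGF]

lemma partGF_mul_int : partGF ℤ * pentagonalSeries ℤ = 1 := by
  let _ : TopologicalSpace ℤ := ⊥
  have _ : DiscreteTopology ℤ := ⟨rfl⟩
  open scoped PowerSeries.WithPiTopology in
  have h1 := Nat.Partition.hasProd_genFun (R := ℤ) (fun _ _ => 1)
  open scoped PowerSeries.WithPiTopology in
  have h2 := PowerSeries.WithPiTopology.hasProd_one_sub_X_pow ℤ
  have h3 : Nat.Partition.genFun (R := ℤ) (fun _ _ => 1) = partGF ℤ := by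
    ext n
    simp [partGF, Nat.Partition.coeff_genFun, Finsupp.prod]
  rw [h3] at h1
  open scoped PowerSeries.WithPiTopology in
  have h4 := h1.mul h2
  refine h4.unique ?_
  have h5 : ∀ i : ℕ, (1 + ∑' j : ℕ, (1 : ℤ) • (X : ℤ⟦X⟧) ^ ((i + 1) * (j + 1))) * (1 - X ^ (i + 1)) = 1 := by
    intro i
    open scoped PowerSeries.WithPiTopology in
    have h6 := PowerSeries.WithPiTopology.tsum_pow_mul_one_sub_of_constantCoeff_eq_zero
      (f := (X : ℤ⟦X⟧) ^ (i + 1)) (by simp)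
    open scoped PowerSeries.WithPiTopology in
    have h7 := (PowerSeries.WithPiTopology.summable_pow_of_constantCoeff_eq_zero
      (f := (X : ℤ⟦X⟧) ^ (i + 1)) (by simp)).tsum_eq_zero_add
    rw [h7] at h6
    simpa [pow_mul] using h6
  convert hasProd_one with i
  exact h5 i

lemma map_penta {R S : Type*} [CommRing R] [CommRing S] (f : R →+* S) :
    PowerSeries.map f (pentagonalSeries R) = pentagonalSeries S := by
  ext n
  by_cases h : n ∈ Set.range pentagonal
  · obtain ⟨k, rfl⟩ := h
    simp only [coeff_map, coeff_pentagonalSeries_pentagonal]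
    simp
  · simp [coeff_pentagonalSeries_eq_zero _ h]

lemma partGF_mul (R : Type*) [CommRing R] : partGF R * pentagonalSeries R = 1 := by
  have := congrArg (PowerSeries.map (Int.castRingHom R)) partGF_mul_int
  rw [map_mul, map_penta, map_one] at this
  rw [← this]; congr 1
  ext n; simp [partGF]


lemma pow_seventeen (f : (ZMod 17)⟦X⟧) : f ^ 17 = PowerSeries.expand 17 (by norm_num) f := by
  have : Fact (Nat.Prime 17) := ⟨by norm_num⟩
  have h := MvPowerSeries.map_frobenius_expand (σ := Unit) (R := ZMod 17) 17 (by norm_num) (f := f)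
  rw [ZMod.frobenius_zmod, MvPowerSeries.map_id] at h
  exact h.symm

lemma reduce (h : ∀ m, coeff (17 * m) ((X : (ZMod 17)⟦X⟧) ^ 2 * pentagonalSeries (ZMod 17) ^ 48) = 0)
    (n : ℕ) : 17 ∣ multipartition 3 (17 * n + 15) := by
  rw [← ZMod.natCast_eq_zero_iff, ← coeff_partGF_cube]
  set φ := pentagonalSeries (ZMod 17) with hφ
  set G := partGF (ZMod 17)
  have h1 : G * φ = 1 := partGF_mul _
  have h2 : G ^ 3 = φ ^ 48 * (G ^ 3) ^ 17 := by
    calc G ^ 3 = G ^ 3 * (G * φ) ^ 48 := by rw [h1]; ring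
      _ = _ := by ring
  rw [h2, pow_seventeen, coeff_mul]
  refine Finset.sum_eq_zero fun p hp => ?_
  rw [Finset.HasAntidiagonal.mem_antidiagonal] at hp
  by_cases hd : 17 ∣ p.2
  · obtain ⟨c, hc⟩ := hd
    have h3 := h (n + 1 - c)
    have h4 : 17 * (n + 1 - c) = p.1 + 2 := by omega
    rw [h4, coeff_X_pow_mul] at h3
    rw [h3, zero_mul]
  · rw [coeff_expand_of_not_dvd _ _ _ hd, mul_zero]

def conv (l m : List ℕ) : List ℕ :=
  (List.range 33).map fun i => ((List.range (i + 1)).map fun j => l.getD j 0 * m.getD (i - j) 0).sum % 17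

def Rep (f : (ZMod 17)⟦X⟧) (l : List ℕ) : Prop := ∀ i < 33, coeff i f = (l.getD i 0 : ZMod 17)

lemma Rep.mul {f g l m} (hf : Rep f l) (hg : Rep g m) : Rep (f * g) (conv l m) := by
  intro i hi
  rw [coeff_mul, Finset.Nat.sum_antidiagonal_eq_sum_range_succ_mk]
  have : (conv l m).getD i 0 = ((List.range (i + 1)).map fun j => l.getD j 0 * m.getD (i - j) 0).sum % 17 := by
    simp [conv, hi]
  rw [this, ZMod.natCast_mod, ← List.sum_toFinset _ List.nodup_range, Nat.cast_sum, List.toFinset_range]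
  refine Finset.sum_congr rfl fun j hj => ?_
  rw [Finset.mem_range] at hj
  rw [hf j (by omega), hg (i - j) (by omega)]
  push_cast; rfl

def pl : List ℕ := [1,16,16,0,0,1,0,1,0,0,0,0,16,0,0,16,0,0,0,0,0,0,1,0,0,0,1,0,0,0,0,0,0]

lemma rep_penta : Rep (pentagonalSeries (ZMod 17)) pl := by
  have key : ∀ n : ℕ, n < 33 → n ∉ [0,1,2,5,7,12,15,22,26] → n ∉ Set.range pentagonal := by
    rintro n hn hl ⟨k, rfl⟩
    have h2 := two_mul_natCast_pentagonal k
    have h3 : (pentagonal k : ℤ) < 33 := by exact_mod_cast hn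
    have h4 : k ≤ 5 := by nlinarith
    have h5 : -5 ≤ k := by nlinarith
    interval_cases k <;> revert hl hn <;> decide
  have val : ∀ k : ℤ, ∀ n : ℕ, pentagonal k = n →
      coeff n (pentagonalSeries (ZMod 17)) = ((Int.negOnePow k : ℤˣ) : ℤ) := by
    rintro k n rfl
    rw [coeff_pentagonalSeries_pentagonal]
  intro i hi
  by_cases hl : i ∈ [0,1,2,5,7,12,15,22,26]
  · simp only [List.mem_cons, List.not_mem_nil, or_false] at hl
    rcases hl with rfl | rfl | rfl | rfl | rfl | rfl | rfl | rfl | rfl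
    · rw [val 0 _ (by decide)]; decide
    · rw [val 1 _ (by decide)]; decide
    · rw [val (-1) _ (by decide)]; decide
    · rw [val 2 _ (by decide)]; decide
    · rw [val (-2) _ (by decide)]; decide
    · rw [val 3 _ (by decide)]; decide
    · rw [val (-3) _ (by decide)]; decide
    · rw [val 4 _ (by decide)]; decide
    · rw [val (-4) _ (by decide)]; decide
  · rw [coeff_pentagonalSeries_eq_zero _ (key i hi hl)]
    revert hl hi; revert i; decide

lemma rep48 : Rep (pentagonalSeries (ZMod 17) ^ 48)
    (let a := conv pl (conv pl pl); let b := conv a a; let c := conv b b; let d := conv c c; conv d d) := by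
  have h3 := rep_penta.mul (rep_penta.mul rep_penta)
  have h6 := h3.mul h3
  have h12 := h6.mul h6
  have h24 := h12.mul h12
  have h48 := h24.mul h24
  convert h48 using 1
  ring

lemma coeff_15 : coeff 15 (pentagonalSeries (ZMod 17) ^ 48) = 0 := by
  rw [rep48 15 (by norm_num)]
  have : (let a := conv pl (conv pl pl); let b := conv a a; let c := conv b b; let d := conv c c; conv d d).getD 15 0 = 0 := by
    decide +kernel
  rw [this]; rfl

lemma coeff_32 : coeff 32 (pentagonalSeries (ZMod 17) ^ 48) = 0 := by
  rw [rep48 32 (by norm_num)]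
  have : (let a := conv pl (conv pl pl); let b := conv a a; let c := conv b b; let d := conv c c; conv d d).getD 32 0 = 0 := by
    decide +kernel
  rw [this]; rfl

end MP
namespace MP
open PowerSeries UpperHalfPlane Filter Topology

noncomputable def tay (f : ℂ → ℂ) : ℂ⟦X⟧ := .mk fun m ↦ ((m.factorial : ℂ))⁻¹ * iteratedDeriv m f 0

lemma tay_congr {f g : ℂ → ℂ} (h : f =ᶠ[𝓝 0] g) : tay f = tay g := by
  ext m
  simp [tay, h.iteratedDeriv_eq m]

lemma tay_mul {f g : ℂ → ℂ} (hf : AnalyticAt ℂ f 0) (hg : AnalyticAt ℂ g 0) :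
    tay (f * g) = tay f * tay g := by
  ext
  simp only [tay, coeff_mk,
    iteratedDeriv_mul hf.contDiffAt hg.contDiffAt, Finset.mul_sum, PowerSeries.coeff_mul,
    Finset.Nat.sum_antidiagonal_eq_sum_range_succ_mk, Nat.succ_eq_add_one]
  refine Finset.sum_congr rfl fun i hi ↦ ?_
  rw [Nat.cast_choose _ (by grind)]
  field_simp [Nat.factorial_ne_zero]

lemma tay_one : tay 1 = 1 := by
  ext m
  rw [show (1 : ℂ → ℂ) = fun _ => 1 from rfl]
  simp [tay, iteratedDeriv_const, PowerSeries.coeff_one]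
  split_ifs with h <;> simp [h]

lemma tay_id : tay (fun q => q) = X := by
  ext m
  rcases m with _ | _ | m
  · simp [tay]
  · simp [tay, iteratedDeriv_one]
  · simp [tay, iteratedDeriv_succ', coeff_X, iteratedDeriv_const]

lemma tay_pow {f : ℂ → ℂ} (hf : AnalyticAt ℂ f 0) (n : ℕ) : tay (f ^ n) = tay f ^ n := by
  induction n with
  | zero => simp [tay_one]
  | succ n ih => rw [pow_succ, tay_mul (hf.pow n) hf, ih, pow_succ]

lemma tay_sub {f g : ℂ → ℂ} (hf : AnalyticAt ℂ f 0) (hg : AnalyticAt ℂ g 0) :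
    tay (f - g) = tay f - tay g := by
  ext m
  simp [tay, iteratedDeriv_sub hf.contDiffAt hg.contDiffAt, mul_sub]

lemma tay_prod (s : Finset ℕ) :
    tay (fun q => ∏ n ∈ s, (1 - q ^ (n + 1))) = ∏ n ∈ s, (1 - X ^ (n + 1) : ℂ⟦X⟧) := by
  classical
  induction s using Finset.induction_on with
  | empty =>
    simp only [Finset.prod_empty]
    exact tay_one
  | insert a s ha ih =>
    have h1 : AnalyticAt ℂ (fun q : ℂ => q) 0 := analyticAt_id
    have h2 : AnalyticAt ℂ (fun q : ℂ => ∏ n ∈ s, (1 - q ^ (n + 1))) 0 := by fun_prop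
    have h3 : AnalyticAt ℂ (1 : ℂ → ℂ) 0 := analyticAt_const
    rw [Finset.prod_insert ha, ← ih, ← tay_id, ← tay_one, ← tay_pow h1, ← tay_sub h3 (h1.pow _),
      ← tay_mul (h3.sub (h1.pow _)) h2]
    congr 1
    ext q
    simp [Finset.prod_insert ha]

lemma tendsto_iter {ι : Type*} {l : Filter ι} {F : ι → ℂ → ℂ} {f : ℂ → ℂ} {U : Set ℂ} (hU : IsOpen U)
    (hf : TendstoLocallyUniformlyOn F f l U) (hF : ∀ i, AnalyticOnNhd ℂ (F i) U) (m : ℕ) :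
    TendstoLocallyUniformlyOn (fun i => iteratedDeriv m (F i)) (iteratedDeriv m f) l U := by
  induction m with
  | zero => simpa using hf
  | succ m ih =>
    simp only [iteratedDeriv_succ]
    exact ih.deriv (.of_forall fun i => by
      rw [iteratedDeriv_eq_iterate]
      exact ((hF i).iterated_deriv m).differentiableOn) hU

lemma tay_tprod : tay (fun q => ∏' n : ℕ, (1 - q ^ (n + 1))) = pentagonalSeries ℂ := by
  have h0 : (0 : ℂ) ∈ Metric.ball (0 : ℂ) 1 := by simp
  have h1 := ModularForm.multipliableLocallyUniformlyOn_one_sub_pow.hasProdLocallyUniformlyOn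
  rw [hasProdLocallyUniformlyOn_iff_tendstoLocallyUniformlyOn] at h1
  ext m
  have h2 := (tendsto_iter Metric.isOpen_ball h1 (fun i q _ => by
    fun_prop) m).tendsto_at h0
  have h3 : Tendsto (fun s : Finset ℕ => coeff m (tay (fun q => ∏ n ∈ s, (1 - q ^ (n + 1))))) atTop
      (𝓝 (coeff m (tay (fun q => ∏' n : ℕ, (1 - q ^ (n + 1)))))) := by
    simp only [tay, coeff_mk]
    exact h2.const_mul _
  simp only [tay_prod] at h3
  refine tendsto_nhds_unique h3 (tendsto_nhds_of_eventually_eq ?_)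
  exact coeff_prod_one_sub_X_pow_eventually_eq ℂ m

lemma qExp_disc : qExpansion 1 ModularForm.discriminant = X * pentagonalSeries ℂ ^ 24 := by
  have hb : Metric.ball (0 : ℂ) 1 ∈ 𝓝 (0 : ℂ) := Metric.ball_mem_nhds _ one_pos
  have hA : AnalyticAt ℂ (fun q : ℂ => ∏' n : ℕ, (1 - q ^ (n + 1))) 0 :=
    ModularForm.differentiableOn_tprod_one_sub_pow.analyticAt hb
  have h1 : qExpansion 1 ModularForm.discriminant = tay (cuspFunction 1 ModularForm.discriminant) := rfl
  rw [h1, ← tay_tprod, ← tay_id, ← tay_pow hA, ← tay_mul (show AnalyticAt ℂ (fun q : ℂ => q) 0 from analyticAt_id) (hA.pow _)]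
  apply tay_congr
  filter_upwards [hb] with q hq
  rw [ModularForm.discriminant_cuspFunction_eqOn hq]
  simp only [Pi.mul_apply, Pi.pow_apply]
  rw [(ModularForm.multipliable_one_sub_pow (by simpa using hq)).tprod_pow]

end MP
namespace MP
open UpperHalfPlane ModularForm ModularGroup MatrixGroups Matrix.SpecialLinearGroup

noncomputable def hA (j : ℕ) : GL (Fin 2) ℝ :=
  Matrix.GeneralLinearGroup.mkOfDetNeZero !![1, (j : ℝ); 0, 17] (by simp [Matrix.det_fin_two])

noncomputable def hB : GL (Fin 2) ℝ :=
  Matrix.GeneralLinearGroup.mkOfDetNeZero !![17, 0; 0, 1] (by simp [Matrix.det_fin_two])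

def hG (j k m : ℤ) (h : j * k + 1 = 17 * m) : SL(2, ℤ) :=
  ⟨!![j, -m; 17, -k], by rw [Matrix.det_fin_two_of]; linarith⟩

lemma slash_key {k : ℤ} (f : ModularForm 𝒮ℒ k) (γ γ' : SL(2, ℤ)) (A A' : GL (Fin 2) ℝ)
    (h : A * mapGL ℝ γ = mapGL ℝ γ' * A') :
    ((f : ℍ → ℂ) ∣[k] A) ∣[k] γ = (f : ℍ → ℂ) ∣[k] A' := by
  have e : (f : ℍ → ℂ) ∣[k] (mapGL ℝ γ') = f :=
    f.slash_action_eq' _ ⟨γ', rfl⟩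
  change ((f : ℍ → ℂ) ∣[k] A) ∣[k] (mapGL ℝ γ) = _
  rw [← SlashAction.slash_mul, h, SlashAction.slash_mul, e]

lemma gl_entry (g : SL(2, ℤ)) (i j : Fin 2) : ((mapGL ℝ g : GL (Fin 2) ℝ) : Matrix (Fin 2) (Fin 2) ℝ) i j = ((g i j : ℤ) : ℝ) := by
  simp [mapGL_coe_matrix]

lemma A0S : hA 0 * mapGL ℝ S = mapGL ℝ S * hB := by
  ext i j
  rw [Units.val_mul, Units.val_mul, Matrix.mul_apply, Matrix.mul_apply]
  simp only [Fin.sum_univ_two, gl_entry]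
  fin_cases i <;> fin_cases j <;> simp [hA, hB, S]

lemma BS : hB * mapGL ℝ S = mapGL ℝ S * hA 0 := by
  ext i j
  rw [Units.val_mul, Units.val_mul, Matrix.mul_apply, Matrix.mul_apply]
  simp only [Fin.sum_univ_two, gl_entry]
  fin_cases i <;> fin_cases j <;> simp [hA, hB, S]

lemma AS (j k : ℕ) (m : ℤ) (h : (j : ℤ) * k + 1 = 17 * m) :
    hA j * mapGL ℝ S = mapGL ℝ (hG j k m h) * hA k := by
  have h' : (j : ℝ) * k + 1 = 17 * m := by exact_mod_cast h
  ext i j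
  rw [Units.val_mul, Units.val_mul, Matrix.mul_apply, Matrix.mul_apply]
  simp only [Fin.sum_univ_two, gl_entry]
  fin_cases i <;> fin_cases j <;> simp [hA, hG, S] <;> linarith

lemma AT (j : ℕ) : hA j * mapGL ℝ T = mapGL ℝ (1 : SL(2, ℤ)) * hA (j + 1) := by
  ext i j
  rw [Units.val_mul, Units.val_mul, Matrix.mul_apply, Matrix.mul_apply]
  simp only [Fin.sum_univ_two, gl_entry]
  fin_cases i <;> fin_cases j <;> simp [hA, T] <;> ring

lemma A16T : hA 16 * mapGL ℝ T = mapGL ℝ T * hA 0 := by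
  ext i j
  rw [Units.val_mul, Units.val_mul, Matrix.mul_apply, Matrix.mul_apply]
  simp only [Fin.sum_univ_two, gl_entry]
  fin_cases i <;> fin_cases j <;> simp [hA, T] <;> norm_num

def hT17 : SL(2, ℤ) := ⟨!![1, 17; 0, 1], by simp⟩

lemma BT : hB * mapGL ℝ T = mapGL ℝ hT17 * hB := by
  ext i j
  rw [Units.val_mul, Units.val_mul, Matrix.mul_apply, Matrix.mul_apply]
  simp only [Fin.sum_univ_two, gl_entry]
  fin_cases i <;> fin_cases j <;> simp [hB, T, hT17]

/-- the Hecke operator at 17 -/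
noncomputable def heckeFun {k : ℤ} (f : ModularForm 𝒮ℒ k) : ℍ → ℂ :=
  (f : ℍ → ℂ) ∣[k] hB + ∑ j ∈ Finset.range 17, (f : ℍ → ℂ) ∣[k] hA j

lemma hecke_T {k : ℤ} (f : ModularForm 𝒮ℒ k) : heckeFun f ∣[k] T = heckeFun f := by
  rw [heckeFun, SlashAction.add_slash, SlashAction.sum_slash, slash_key f T _ _ _ BT]
  congr 1
  rw [Finset.sum_range_succ, slash_key f T _ _ _ A16T, Finset.sum_range_succ' _ 16]
  congr 1
  exact Finset.sum_congr rfl fun j _ => slash_key f T _ _ _ (AT j)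

lemma hecke_S {k : ℤ} (f : ModularForm 𝒮ℒ k) : heckeFun f ∣[k] S = heckeFun f := by
  rw [heckeFun, SlashAction.add_slash, SlashAction.sum_slash, slash_key f S _ _ _ BS,
    Finset.sum_range_succ' _ 16, slash_key f S _ _ _ A0S, Finset.sum_range_succ' _ 16]
  have : ∑ j ∈ Finset.range 16, ((f : ℍ → ℂ) ∣[k] hA (j + 1)) ∣[k] S
      = ∑ j ∈ Finset.range 16, (f : ℍ → ℂ) ∣[k] hA (j + 1) := by
    have hd : ∀ j ∈ Finset.range 16, 17 ∣ (j + 1) * ((16 * (j + 1) ^ 15) % 17) + 1 := by decide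
    have hp : ∀ j ∈ Finset.range 16, (16 * (j + 1) ^ 15) % 17 - 1 + 1 = (16 * (j + 1) ^ 15) % 17 := by
      decide
    refine Finset.sum_nbij' (fun j => (16 * (j + 1) ^ 15) % 17 - 1)
      (fun j => (16 * (j + 1) ^ 15) % 17 - 1) (by decide) (by decide) (by decide) (by decide) ?_
    intro j hj
    obtain ⟨m, hm⟩ := hd j hj
    refine slash_key f S (hG (j + 1 : ℕ) ((16 * (j + 1) ^ 15) % 17 : ℕ) m (by exact_mod_cast hm)) _ _ ?_
    simp only [hp j hj]
    exact AS _ _ _ _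
  rw [this]
  abel

lemma hecke_inv {k : ℤ} (f : ModularForm 𝒮ℒ k) (γ : SL(2, ℤ)) : heckeFun f ∣[k] γ = heckeFun f :=
  SlashInvariantForm.slash_action_generators_SL2Z (hecke_S f) (hecke_T f) γ


lemma slash_hA (f : ℍ → ℂ) (j : ℕ) (τ : ℍ) : (f ∣[(24 : ℤ)] hA j) τ = 17⁻¹ * f (hA j • τ) := by
  rw [ModularForm.slash_apply]
  have hd : (hA j).det.val = 17 := by simp [hA]
  have hs : σ (hA j) = ContinuousAlgEquiv.refl ℝ ℂ := by
    rw [σ, if_pos]; rw [hd]; norm_num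
  have hden : denom (hA j) τ = 17 := by simp [denom, hA]
  rw [hd, hs, hden]
  norm_num
  ring

lemma slash_hB (f : ℍ → ℂ) (τ : ℍ) : (f ∣[(24 : ℤ)] hB) τ = 17 ^ 23 * f (hB • τ) := by
  rw [ModularForm.slash_apply]
  have hd : hB.det.val = 17 := by simp [hB]
  have hs : σ hB = ContinuousAlgEquiv.refl ℝ ℂ := by
    rw [σ, if_pos]; rw [hd]; norm_num
  have hden : denom hB τ = 1 := by simp [denom, hB]
  rw [hd, hs, hden]
  norm_num
  ring

lemma coe_hA (j : ℕ) (τ : ℍ) : ((hA j • τ : ℍ) : ℂ) = (τ + j) / 17 := by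
  have hd : (hA j).det.val = 17 := by simp [hA]
  rw [coe_smul_of_det_pos (by rw [hd]; norm_num)]
  simp [num, denom, hA]

lemma coe_hB (τ : ℍ) : ((hB • τ : ℍ) : ℂ) = 17 * τ := by
  have hd : hB.det.val = 17 := by simp [hB]
  rw [coe_smul_of_det_pos (by rw [hd]; norm_num)]
  simp [num, denom, hB]

end MP
namespace MP
open UpperHalfPlane ModularForm ModularGroup MatrixGroups Matrix.SpecialLinearGroup
open Function.Periodic
open scoped Manifold

lemma root_sum {ζ : ℂ} (hζ : IsPrimitiveRoot ζ 17) (m : ℕ) :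
    ∑ j ∈ Finset.range 17, (ζ ^ j) ^ m = if 17 ∣ m then 17 else 0 := by
  have e : ∀ j, (ζ ^ j) ^ m = (ζ ^ m) ^ j := fun j => by rw [← pow_mul, ← pow_mul, mul_comm]
  simp only [e]
  split_ifs with h
  · rw [(hζ.pow_eq_one_iff_dvd m).2 h]; simp
  · have h1 : ζ ^ m - 1 ≠ 0 := fun h0 => h ((hζ.pow_eq_one_iff_dvd m).1 (by linear_combination h0))
    have h2 := geom_sum_mul (ζ ^ m) 17
    rw [← pow_mul, mul_comm m 17, pow_mul, hζ.pow_eq_one, one_pow, sub_self] at h2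
    exact (mul_eq_zero.1 h2).resolve_right h1

noncomputable def heckeCoeff (a : ℕ → ℂ) (m : ℕ) : ℂ :=
  (if 17 ∣ m then 17 ^ 23 * a (m / 17) else 0) + a (17 * m)

lemma hecke_hasSum (f : ModularForm 𝒮ℒ 24) (τ : ℍ) :
    HasSum (fun m => heckeCoeff (fun n => (qExpansion 1 f).coeff n) m • qParam 1 τ ^ m) (heckeFun f τ) := by
  set a : ℕ → ℂ := fun n => (qExpansion 1 f).coeff n with ha
  have hs : ∀ τ : ℍ, HasSum (fun m ↦ a m * qParam 1 τ ^ m) (f τ) := fun τ =>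
    ModularForm.hasSum_qExpansion f one_pos one_mem_strictPeriods_SL τ
  have hinj : Function.Injective (fun m : ℕ => 17 * m) := fun x y h => by simpa using h
  have hB1 : HasSum (fun m => (if 17 ∣ m then 17 ^ 23 * a (m / 17) else 0) * qParam 1 τ ^ m)
      (((f : ℍ → ℂ) ∣[(24 : ℤ)] hB) τ) := by
    rw [slash_hB, ← hinj.hasSum_iff]
    · have := (hs (hB • τ)).mul_left ((17 : ℂ) ^ 23)
      have hq : qParam 1 (hB • τ : ℍ) = qParam 1 τ ^ 17 := by
        rw [coe_hB, qParam, qParam, ← Complex.exp_nat_mul]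
        congr 1
        push_cast
        ring
      refine Eq.mp (congrArg (fun g => HasSum g _) ?_) this
      funext m
      simp only [Function.comp, hq, ← pow_mul, dvd_mul_right, if_true]
      rw [Nat.mul_div_cancel_left _ (by norm_num)]
      ring
    · intro x hx
      rw [if_neg, zero_mul]
      rintro ⟨y, rfl⟩
      exact hx ⟨y, rfl⟩
  have hA1 : HasSum (fun m => a (17 * m) * qParam 1 τ ^ m)
      (∑ j ∈ Finset.range 17, ((f : ℍ → ℂ) ∣[(24 : ℤ)] hA j) τ) := by
    have hζ := Complex.isPrimitiveRoot_exp 17 (by norm_num)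
    set ζ := Complex.exp (2 * Real.pi * Complex.I / (17 : ℕ)) with hζd
    set w := Complex.exp (2 * Real.pi * Complex.I * τ / 17) with hw
    have hq : ∀ j, qParam 1 (hA j • τ : ℍ) = w * ζ ^ j := fun j => by
      rw [coe_hA, qParam, hw, hζd, ← Complex.exp_nat_mul, ← Complex.exp_add]
      congr 1
      push_cast
      ring
    have hw17 : w ^ 17 = qParam 1 τ := by
      rw [hw, qParam, ← Complex.exp_nat_mul]
      congr 1
      push_cast
      ring
    have h1 : HasSum (fun m => ∑ j ∈ Finset.range 17, 17⁻¹ * (a m * (w * ζ ^ j) ^ m))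
        (∑ j ∈ Finset.range 17, ((f : ℍ → ℂ) ∣[(24 : ℤ)] hA j) τ) := by
      refine hasSum_sum fun j _ => ?_
      rw [slash_hA, ← hq]
      exact (hs _).mul_left _
    have h2 : ∀ m, ∑ j ∈ Finset.range 17, 17⁻¹ * (a m * (w * ζ ^ j) ^ m)
        = if 17 ∣ m then a m * w ^ m else 0 := fun m => by
      have : ∀ j, 17⁻¹ * (a m * (w * ζ ^ j) ^ m) = (17⁻¹ * a m * w ^ m) * (ζ ^ j) ^ m := fun j => by
        rw [mul_pow]; ring
      simp only [this, ← Finset.mul_sum, root_sum hζ]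
      split_ifs
      · ring
      · simp
    simp only [h2] at h1
    rw [← hinj.hasSum_iff] at h1
    · convert h1 using 2 with m
      simp [pow_mul, hw17]
    · intro x hx
      rw [if_neg]
      rintro ⟨y, rfl⟩
      exact hx ⟨y, rfl⟩
  convert hB1.add hA1 using 2 with m
  · simp [heckeCoeff, add_mul]
  · simp [heckeFun]

noncomputable def hecke (f : ModularForm 𝒮ℒ 24) : ModularForm 𝒮ℒ 24 where
  toFun := heckeFun f
  slash_action_eq' := fun _ ⟨γ, hγ⟩ ↦ hγ ▸ hecke_inv f γ
  holo' := by
    have h := f.holo'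
    refine (MDifferentiable.slash h _ _).add ?_
    have : ∀ s : Finset ℕ, MDifferentiable 𝓘(ℂ) 𝓘(ℂ) (∑ j ∈ s, (f : ℍ → ℂ) ∣[(24 : ℤ)] hA j) := by
      intro s
      induction s using Finset.induction_on with
      | empty => rw [Finset.sum_empty]; exact mdifferentiable_const (c := (0 : ℂ))
      | insert x s hx ih => rw [Finset.sum_insert hx]; exact (MDifferentiable.slash h _ _).add ih
    exact this _
  bdd_at_cusps' {c} hc := by
    rw [Subgroup.IsArithmetic.isCusp_iff_isCusp_SL2Z] at hc
    rw [OnePoint.isBoundedAt_iff_forall_SL2Z hc]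
    intro γ _
    have := hecke_inv f γ
    change IsBoundedAtImInfty (heckeFun f ∣[(24 : ℤ)] γ)
    rw [this]
    exact isBoundedAtImInfty_of_hasSum_qExpansion one_pos (hecke_hasSum f)

lemma hecke_coeff (f : ModularForm 𝒮ℒ 24) (m : ℕ) :
    (qExpansion 1 (hecke f)).coeff m = heckeCoeff (fun n => (qExpansion 1 f).coeff n) m :=
  (ModularFormClass.qExpansion_coeff_unique one_pos one_mem_strictPeriods_SL (f := hecke f)
    (hecke_hasSum f) m).symm

end MP
namespace MP
open PowerSeries UpperHalfPlane ModularForm MatrixGroups Matrix.SpecialLinearGroup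

noncomputable def aZ : ℤ⟦X⟧ := X ^ 2 * pentagonalSeries ℤ ^ 48

noncomputable def eZ : ℤ⟦X⟧ := PowerSeries.mk fun m =>
  if m = 0 then 1 else 240 * (ArithmeticFunction.sigma 3 m : ℤ)

noncomputable def wZ : ℤ⟦X⟧ := X * pentagonalSeries ℤ ^ 24 * eZ ^ 3

lemma wZ_zero : coeff 0 wZ = 0 := by
  simp [wZ]

lemma penta_zero : constantCoeff (pentagonalSeries ℤ) = 1 := by
  have := coeff_pentagonalSeries_pentagonal ℤ 0
  simpa [pentagonal] using this

lemma wZ_one : coeff 1 wZ = 1 := by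
  rw [wZ, mul_assoc, show (1 : ℕ) = 0 + 1 from rfl, coeff_succ_X_mul]
  have h2 : constantCoeff eZ = 1 := by
    rw [← coeff_zero_eq_constantCoeff_apply]
    simp [eZ]
  simp [penta_zero, h2]

lemma aZ_zero : coeff 0 aZ = 0 := by simp [aZ]
lemma aZ_one : coeff 1 aZ = 0 := by
  rw [aZ, coeff_X_pow_mul']; simp
lemma aZ_two : coeff 2 aZ = 1 := by
  rw [aZ, coeff_X_pow_mul']; simp [penta_zero]

noncomputable def dF : ModularForm 𝒮ℒ 12 where
  toFun := CuspForm.discriminant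
  slash_action_eq' := CuspForm.discriminant.slash_action_eq'
  holo' := CuspForm.discriminant.holo'
  bdd_at_cusps' hc := ModularFormClass.bdd_at_cusps CuspForm.discriminant hc

noncomputable def fF : ModularForm 𝒮ℒ 24 := ModularForm.mcast (by norm_num) (dF.pow 2)

noncomputable def gF : ModularForm 𝒮ℒ 24 := ModularForm.mcast (by norm_num) (dF.mul (E₄.pow 3))

lemma q_dF : qExpansion 1 dF = X * pentagonalSeries ℂ ^ 24 := qExp_disc

lemma q_fF : qExpansion 1 fF = PowerSeries.map (Int.castRingHom ℂ) aZ := by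
  have h : qExpansion 1 fF = qExpansion 1 (dF.pow 2) := rfl
  rw [h, ModularForm.qExpansion_pow one_pos one_mem_strictPeriods_SL, q_dF, aZ]
  simp only [map_mul, map_pow, map_X, map_penta]
  ring

lemma q_E : qExpansion 1 E₄ = PowerSeries.map (Int.castRingHom ℂ) eZ := by
  ext m
  rw [EisensteinSeries.E_qExpansion_coeff _ ⟨2, rfl⟩, show bernoulli 4 = -1 / 30 by decide +kernel]
  simp only [eZ, coeff_map, coeff_mk]
  split_ifs
  · simp
  · norm_num

lemma q_gF : qExpansion 1 gF = PowerSeries.map (Int.castRingHom ℂ) wZ := by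
  have h : qExpansion 1 gF = qExpansion 1 (dF.mul (E₄.pow 3)) := rfl
  rw [h, ModularForm.qExpansion_mul one_pos one_mem_strictPeriods_SL,
    ModularForm.qExpansion_pow one_pos one_mem_strictPeriods_SL, q_dF, q_E, wZ]
  simp only [map_mul, map_pow, map_X, map_penta]

lemma hecke_id (m : ℕ) :
    (if 17 ∣ m then 17 ^ 23 * coeff (m / 17) aZ else 0) + coeff (17 * m) aZ =
      coeff 17 aZ * coeff m wZ + (coeff 34 aZ - coeff 17 aZ * coeff 2 wZ) * coeff m aZ := by
  set c1 : ℂ := ((coeff 17 aZ : ℤ) : ℂ) with hc1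
  set c2 : ℂ := ((coeff 34 aZ - coeff 17 aZ * coeff 2 wZ : ℤ) : ℂ) with hc2
  set G : ModularForm 𝒮ℒ 24 := hecke fF - (c1 • gF + c2 • fF) with hG
  have hq : qExpansion 1 G = qExpansion 1 (hecke fF) - (c1 • qExpansion 1 gF + c2 • qExpansion 1 fF) := by
    rw [← ModularForm.qExpansion_smul one_pos one_mem_strictPeriods_SL,
      ← ModularForm.qExpansion_smul one_pos one_mem_strictPeriods_SL]
    have e1 := ModularForm.qExpansion_add one_pos one_mem_strictPeriods_SL (c1 • gF) (c2 • fF)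
    have e2 := ModularForm.qExpansion_sub one_pos one_mem_strictPeriods_SL (hecke fF)
      (c1 • gF + c2 • fF)
    exact e2.trans (congrArg _ e1)
  have hc : ∀ m, coeff m (qExpansion 1 G) =
      (((if 17 ∣ m then 17 ^ 23 * coeff (m / 17) aZ else 0) + coeff (17 * m) aZ -
      (coeff 17 aZ * coeff m wZ + (coeff 34 aZ - coeff 17 aZ * coeff 2 wZ) * coeff m aZ) : ℤ) : ℂ) := by
    intro m
    rw [hq, map_sub, map_add, hecke_coeff, q_fF, q_gF]
    simp only [heckeCoeff, coeff_map, coeff_smul, smul_eq_mul, eq_intCast, hc1, hc2]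
    push_cast
    ring
  have hord : (3 : ℕ) ≤ (qExpansion 1 G).order := by
    apply nat_le_order
    intro i hi
    rw [hc]
    interval_cases i
    · simp [aZ_zero, wZ_zero]
    · simp [aZ_one, wZ_one]
    · simp [aZ_two]
  have h0 : G = 0 := by
    apply sturm_bound_levelOne
    refine lt_of_lt_of_le ?_ hord
    exact Nat.cast_lt.2 (by decide)
  have h1 := hc m
  have h2 : qExpansion 1 G = 0 := by
    rw [h0]; exact qExpansion_zero 1
  rw [h2, map_zero] at h1
  have h3 := Int.cast_injective (α := ℂ) (h1.symm.trans Int.cast_zero.symm)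
  linarith

lemma aZ_mod (m : ℕ) : ((coeff m aZ : ℤ) : ZMod 17)
    = coeff m ((X : (ZMod 17)⟦X⟧) ^ 2 * pentagonalSeries (ZMod 17) ^ 48) := by
  rw [← map_penta (Int.castRingHom (ZMod 17)), ← map_X (Int.castRingHom (ZMod 17)), ← map_pow,
    ← map_pow, ← map_mul, coeff_map]
  rfl

lemma final (m : ℕ) :
    coeff (17 * m) ((X : (ZMod 17)⟦X⟧) ^ 2 * pentagonalSeries (ZMod 17) ^ 48) = 0 := by
  have h := congrArg (Int.cast : ℤ → ZMod 17) (hecke_id m)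
  have e17 : ((coeff 17 aZ : ℤ) : ZMod 17) = 0 := by
    rw [aZ_mod, show 17 = 15 + 2 from rfl, coeff_X_pow_mul, coeff_15]
  have e34 : ((coeff 34 aZ : ℤ) : ZMod 17) = 0 := by
    rw [aZ_mod, show 34 = 32 + 2 from rfl, coeff_X_pow_mul, coeff_32]
  have z : (19967568900859523802559065713 : ZMod 17) = 0 := by reduce_mod_char
  push_cast at h
  rw [e17, e34, z] at h
  rw [← aZ_mod]
  simpa using h

end MP

theorem multipartition_three_seventeen (n : ℕ) : 17 ∣ multipartition 3 (17 * n + 15) := by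
  exact MP.reduce MP.final n
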